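/- arXiv:2404.05132 — 8 statements merged into one kernel-verified Lean document; each statement's English description precedes it below -/
import Mathlib

section
/- Let k ∈ ℕ, let b ∈ ℝ with b > 2 − k, and let h : ℝ → ℝ be continuously differentiable on (0,∞) with t·h'(t) ≥ b for all t > 0. Then for every continuously differentiable function ξ : ℝ → ℝ with compact support contained in (0,∞), ((k−2+b)/2)² · ∫₀^∞ ξ(r)² r^{k−3} e^{h(r)} dr ≤ ∫₀^∞ ξ'(r)² r^{k−1} e^{h(r)} dr. -/
open MeasureTheory

/-- A function continuous on an open set and vanishing off a compact subset of it is integrable. -/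
theorem ContinuousOn.integrable_of_eq_zero_off_compact {f : ℝ → ℝ} {K U : Set ℝ}
    (hf : ContinuousOn f U) (hK : IsCompact K) (hKU : K ⊆ U) (h0 : ∀ x ∉ K, f x = 0) :
    Integrable f := by
  refine (integrableOn_iff_integrable_of_support_subset ?_).1
    ((hf.mono hKU).integrableOn_compact hK)
  intro x hx
  by_contra hxK
  exact hx (h0 x hxK)

/-- Radial weighted Hardy-type inequality: if `t h'(t) ≥ b > 2 − k` on `(0,∞)` then for every
`C¹` function `ξ` compactly supported in `(0,∞)`,
`((k−2+b)/2)² ∫₀^∞ ξ² r^{k−3} e^{h} dr ≤ ∫₀^∞ (ξ')² r^{k−1} e^{h} dr`. -/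
theorem radial_hardy_inequality (k : ℕ) (b : ℝ) (hb : b > 2 - (k : ℝ)) (h : ℝ → ℝ)
    (hh : ContDiffOn ℝ 1 h (Set.Ioi 0))
    (hb' : ∀ t > (0 : ℝ), t * deriv h t ≥ b)
    (ξ : ℝ → ℝ) (hξ : ContDiff ℝ 1 ξ) (hcs : HasCompactSupport ξ)
    (hsupp : tsupport ξ ⊆ Set.Ioi 0) :
    (((k : ℝ) - 2 + b) / 2) ^ 2 *
        ∫ r in Set.Ioi (0 : ℝ), ξ r ^ 2 * r ^ ((k : ℝ) - 3) * Real.exp (h r) ≤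
      ∫ r in Set.Ioi (0 : ℝ), (deriv ξ r) ^ 2 * r ^ ((k : ℝ) - 1) * Real.exp (h r) := by
  set c : ℝ := ((k : ℝ) - 2 + b) / 2 with hc
  have hc0 : 0 < c := by rw [hc]; linarith
  have hξ0 : ∀ x ∉ tsupport ξ, ξ x = 0 := fun x hx => image_eq_zero_of_notMem_tsupport hx
  have hdξ0 : ∀ x ∉ tsupport ξ, deriv ξ x = 0 := fun x hx =>
    image_eq_zero_of_notMem_tsupport fun hx' => hx (tsupport_deriv_subset hx')
  have hξc : ContinuousOn ξ (Set.Ioi 0) := hξ.continuous.continuousOn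
  have hdξc : ContinuousOn (deriv ξ) (Set.Ioi 0) :=
    (hξ.continuous_deriv le_rfl).continuousOn
  have hec : ContinuousOn (fun r => Real.exp (h r)) (Set.Ioi 0) := hh.continuousOn.rexp
  have hdhc : ContinuousOn (deriv h) (Set.Ioi 0) :=
    hh.continuousOn_deriv_of_isOpen isOpen_Ioi le_rfl
  have hpc : ∀ p : ℝ, ContinuousOn (fun r : ℝ => r ^ p) (Set.Ioi 0) := fun p =>
    continuousOn_id.rpow_const fun x hx => Or.inl (ne_of_gt hx)
  have integrable_of : ∀ f : ℝ → ℝ, ContinuousOn f (Set.Ioi 0) →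
      (∀ x ∉ tsupport ξ, f x = 0) → Integrable f := fun f hf h0 =>
    hf.integrable_of_eq_zero_off_compact hcs hsupp h0
  let A : ℝ → ℝ := fun r => ξ r ^ 2 * r ^ ((k : ℝ) - 3) * Real.exp (h r)
  let B : ℝ → ℝ := fun r => (deriv ξ r) ^ 2 * r ^ ((k : ℝ) - 1) * Real.exp (h r)
  let G : ℝ → ℝ := fun r => ξ r ^ 2 * r ^ ((k : ℝ) - 2) * Real.exp (h r)
  let G' : ℝ → ℝ := fun r =>
    (2 * ξ r * deriv ξ r * r ^ ((k : ℝ) - 2) + ξ r ^ 2 * (((k : ℝ) - 2) * r ^ ((k : ℝ) - 3))) *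
      Real.exp (h r) + ξ r ^ 2 * r ^ ((k : ℝ) - 2) * (Real.exp (h r) * deriv h r)
  have hA : Integrable A := integrable_of A (((hξc.pow 2).mul (hpc _)).mul hec)
    fun x hx => by simp [A, hξ0 x hx]
  have hB : Integrable B := integrable_of B (((hdξc.pow 2).mul (hpc _)).mul hec)
    fun x hx => by simp [B, hdξ0 x hx]
  have hG : Integrable G := integrable_of G (((hξc.pow 2).mul (hpc _)).mul hec)
    fun x hx => by simp [G, hξ0 x hx]
  have hG'0 : ∀ x ∉ tsupport ξ, G' x = 0 := fun x hx => by simp [G', hξ0 x hx]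
  have hG' : Integrable G' := by
    refine integrable_of G' ?_ hG'0
    exact (((((continuousOn_const.mul hξc).mul hdξc).mul (hpc _)).add
      ((hξc.pow 2).mul (continuousOn_const.mul (hpc _)))).mul hec).add
      (((hξc.pow 2).mul (hpc _)).mul (hec.mul hdhc))
  have hderiv : ∀ x, HasDerivAt G (G' x) x := by
    intro x
    by_cases hx : x ∈ tsupport ξ
    · have hx0 : 0 < x := hsupp hx
      have h1 : HasDerivAt ξ (deriv ξ x) x :=
        (hξ.differentiable one_ne_zero x).hasDerivAt
      have h2 : HasDerivAt h (deriv h x) x :=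
        ((hh.contDiffAt (Ioi_mem_nhds hx0)).differentiableAt one_ne_zero).hasDerivAt
      have h3 := Real.hasDerivAt_rpow_const (p := (k : ℝ) - 2) (Or.inl hx0.ne')
      refine (((h1.pow 2).mul h3).mul h2.exp).congr_deriv ?_
      have e : (k : ℝ) - 2 - 1 = (k : ℝ) - 3 := by ring
      simp only [G', e, Pi.pow_apply, Pi.mul_apply]
      norm_num
    · rw [hG'0 x hx]
      refine (hasDerivAt_const x (0 : ℝ)).congr_of_eventuallyEq ?_
      filter_upwards [(isClosed_tsupport ξ).isOpen_compl.mem_nhds hx] with y hy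
      simp [G, hξ0 y hy]
  have hG'int : ∫ r in Set.Ioi (0 : ℝ), G' r = 0 := by
    rw [setIntegral_eq_integral_of_forall_compl_eq_zero
      fun x hx => hG'0 x fun hx' => hx (hsupp hx')]
    exact integral_eq_zero_of_hasDerivAt_of_integrable hderiv hG' hG
  have hpt : ∀ r ∈ Set.Ioi (0 : ℝ), c ^ 2 * A r - c * G' r ≤ B r := by
    intro r hr
    have hr0 : 0 < r := hr
    have e2 : r ^ ((k : ℝ) - 2) = r * r ^ ((k : ℝ) - 3) := by
      nth_rewrite 2 [← Real.rpow_one r]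
      rw [← Real.rpow_add hr0]
      congr 1
      ring
    have e1 : r ^ ((k : ℝ) - 1) = r ^ 2 * r ^ ((k : ℝ) - 3) := by
      rw [← Real.rpow_natCast, ← Real.rpow_add hr0]
      congr 1
      push_cast
      ring
    have hW : 0 < r ^ ((k : ℝ) - 3) * Real.exp (h r) := by positivity
    have hdiff : B r - (c ^ 2 * A r - c * G' r) =
        (r ^ ((k : ℝ) - 3) * Real.exp (h r)) *
          ((r * deriv ξ r + c * ξ r) ^ 2 + c * ξ r ^ 2 * (r * deriv h r - b)) := by
      simp only [A, B, G', e1, e2]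
      have hb2 : b = 2 * c - k + 2 := by rw [hc]; ring
      rw [hb2]
      ring
    have hnn : 0 ≤ r * deriv h r - b := sub_nonneg.2 (hb' r hr0)
    have : 0 ≤ B r - (c ^ 2 * A r - c * G' r) := by
      rw [hdiff]
      positivity
    linarith
  calc c ^ 2 * ∫ r in Set.Ioi (0 : ℝ), A r
      = ∫ r in Set.Ioi (0 : ℝ), (c ^ 2 * A r - c * G' r) := by
        rw [integral_sub (hA.integrableOn.const_mul _) (hG'.integrableOn.const_mul _),
          integral_const_mul, integral_const_mul, hG'int]
        ring
    _ ≤ ∫ r in Set.Ioi (0 : ℝ), B r :=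
        setIntegral_mono_on ((hA.const_mul _).sub (hG'.const_mul _)).integrableOn
          hB.integrableOn measurableSet_Ioi hpt
end

section
/- Let k ≥ 1, let b ∈ ℝ with b > 2 − k, and let h : ℝ → ℝ be continuously differentiable on (0,∞) with t·h'(t) ≥ b for all t > 0. Then for every continuously differentiable function ξ : EuclideanSpace ℝ (Fin k) → ℝ whose (compact) support does not contain the origin, ((k−2+b)/2)² · ∫_{ℝᵏ} ξ(x)² ‖x‖^{−2} e^{h(‖x‖)} dx ≤ ∫_{ℝᵏ} ‖∇ξ(x)‖² e^{h(‖x‖)} dx, where the integrals are with respect to Lebesgue measure on EuclideanSpace ℝ (Fin k). -/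
open MeasureTheory

/-- The divergence theorem for the radial field `w(x) x`: if `w` is `C¹` with compact support, then
the integral of `div (w x) = k w + Dw(x) x` vanishes. -/
theorem integral_mul_add_fderiv_self_eq_zero {k : ℕ} {w : EuclideanSpace ℝ (Fin k) → ℝ}
    (hw : ContDiff ℝ 1 w) (hc : HasCompactSupport w) :
    ∫ x, ((k : ℝ) * w x + fderiv ℝ w x x) = 0 := by
  have hw' : Continuous (fderiv ℝ w) := hw.continuous_fderiv one_ne_zero
  have hint : ∀ i : Fin k, Integrable (fun x : EuclideanSpace ℝ (Fin k) ↦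
      fderiv ℝ w x (EuclideanSpace.single i 1) * x i) := fun i ↦ by
    refine Continuous.integrable_of_hasCompactSupport (by fun_prop) ?_
    exact (hc.fderiv_apply ℝ (EuclideanSpace.single i 1)).mul_right
  have hwint : Integrable w := hw.continuous.integrable_of_hasCompactSupport hc
  have hcoord : ∀ (i : Fin k) (x : EuclideanSpace ℝ (Fin k)),
      fderiv ℝ (fun y : EuclideanSpace ℝ (Fin k) ↦ y i) x (EuclideanSpace.single i 1) = 1 := by
    intro i x
    have : HasFDerivAt (fun y : EuclideanSpace ℝ (Fin k) ↦ y i)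
      (EuclideanSpace.proj i : EuclideanSpace ℝ (Fin k) →L[ℝ] ℝ) x :=
      (EuclideanSpace.proj i : EuclideanSpace ℝ (Fin k) →L[ℝ] ℝ).hasFDerivAt
    rw [this.fderiv]
    simp
  have hparts : ∀ i : Fin k, ∫ x : EuclideanSpace ℝ (Fin k),
      (w x + fderiv ℝ w x (EuclideanSpace.single i 1) * x i) = 0 := fun i ↦ by
    have := integral_mul_fderiv_eq_neg_fderiv_mul_of_integrable (μ := volume) (f := w)
      (g := fun y : EuclideanSpace ℝ (Fin k) ↦ y i) (v := EuclideanSpace.single i 1)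
      (hint i) (by simpa only [hcoord, mul_one] using hwint)
      (Continuous.integrable_of_hasCompactSupport (by fun_prop) hc.mul_right)
      (fun x _ ↦ hw.differentiable one_ne_zero x) (fun x _ ↦ by fun_prop)
    simp only [hcoord, mul_one] at this
    rw [integral_add hwint (hint i), this, neg_add_cancel]
  have hsum : ∀ x : EuclideanSpace ℝ (Fin k), (k : ℝ) * w x + fderiv ℝ w x x =
      ∑ i, (w x + fderiv ℝ w x (EuclideanSpace.single i 1) * x i) := fun x ↦ by
    rw [Finset.sum_add_distrib]
    congr 1
    · simp
    · have := congrArg (fderiv ℝ w x) ((EuclideanSpace.basisFun (Fin k) ℝ).sum_repr x)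
      rw [← this, map_sum]
      simp [mul_comm]
  simp_rw [hsum]
  refine (integral_finsetSum _ fun i _ ↦ hwint.add (hint i)).trans ?_
  exact Finset.sum_eq_zero fun i _ ↦ hparts i

/-- The derivative of `f² ψ(‖x‖)` in the radial direction. -/
theorem fderiv_sq_mul_comp_norm_self {E : Type*} [NormedAddCommGroup E] [InnerProductSpace ℝ E]
    {f : E → ℝ} {ψ : ℝ → ℝ} {ψ' : ℝ} {x : E} (hf : DifferentiableAt ℝ f x) (hx : x ≠ 0)
    (hψ : HasDerivAt ψ ψ' ‖x‖) :
    fderiv ℝ (fun y ↦ f y ^ 2 * ψ ‖y‖) x x =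
      2 * f x * fderiv ℝ f x x * ψ ‖x‖ + f x ^ 2 * (ψ' * ‖x‖) := by
  have hn : DifferentiableAt ℝ (fun y : E ↦ ‖y‖) x := (contDiffAt_norm ℝ hx).differentiableAt
    one_ne_zero
  have h1 := (hf.hasFDerivAt.pow 2).mul (hψ.comp_hasFDerivAt x hn.hasFDerivAt)
  rw [show (fun y ↦ f y ^ 2 * ψ ‖y‖) = (fun y ↦ f y ^ 2) * ψ ∘ norm from rfl, h1.fderiv]
  simp [hn.fderiv_norm_self]
  ring

/-- Weighted Hardy-type inequality on `ℝᵏ`: if `t h'(t) ≥ b > 2 − k` on `(0,∞)` then for every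
`C¹` function `ξ` with compact support avoiding the origin,
`((k−2+b)/2)² ∫ ξ² ‖x‖^{−2} e^{h(‖x‖)} dx ≤ ∫ ‖∇ξ‖² e^{h(‖x‖)} dx`. -/
theorem hardy_inequality_euclidean (k : ℕ) (hk : 1 ≤ k) (b : ℝ) (hb : b > 2 - (k : ℝ))
    (h : ℝ → ℝ) (hh : ContDiffOn ℝ 1 h (Set.Ioi 0))
    (hb' : ∀ t > (0 : ℝ), t * deriv h t ≥ b)
    (ξ : EuclideanSpace ℝ (Fin k) → ℝ) (hξ : ContDiff ℝ 1 ξ)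
    (hcs : HasCompactSupport ξ) (h0 : (0 : EuclideanSpace ℝ (Fin k)) ∉ tsupport ξ) :
    (((k : ℝ) - 2 + b) / 2) ^ 2 *
        ∫ x : EuclideanSpace ℝ (Fin k), ξ x ^ 2 * ‖x‖ ^ (-2 : ℝ) * Real.exp (h ‖x‖) ≤
      ∫ x : EuclideanSpace ℝ (Fin k), ‖gradient ξ x‖ ^ 2 * Real.exp (h ‖x‖) := by
  set a : ℝ := (k : ℝ) - 2 + b with ha
  have ha0 : 0 < a := by linarith
  set ψ : ℝ → ℝ := fun t ↦ (t ^ 2)⁻¹ * Real.exp (h t) with hψ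
  set w : EuclideanSpace ℝ (Fin k) → ℝ := fun x ↦ ξ x ^ 2 * ψ ‖x‖ with hw
  have hweq : ∀ x, ξ x ^ 2 * ‖x‖ ^ (-2 : ℝ) * Real.exp (h ‖x‖) = w x := fun x ↦ by
    rw [hw, hψ, Real.rpow_neg (norm_nonneg x), Real.rpow_two, mul_assoc]
  have hgrad : ∀ x, ‖gradient ξ x‖ = ‖fderiv ℝ ξ x‖ := fun x ↦ by simp [gradient]
  simp_rw [hweq, hgrad]
  have hne : ∀ x ∈ tsupport ξ, x ≠ 0 := fun x hx hx0 ↦ h0 (hx0 ▸ hx)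
  have hhat : ∀ t, 0 < t → ContDiffAt ℝ 1 h t := fun t ht ↦ hh.contDiffAt (Ioi_mem_nhds ht)
  have hhn : ∀ x : EuclideanSpace ℝ (Fin k), x ≠ 0 →
      ContDiffAt ℝ 1 (fun y : EuclideanSpace ℝ (Fin k) ↦ h ‖y‖) x := fun x hx ↦
    (hhat _ (norm_pos_iff.2 hx)).comp x (contDiffAt_norm ℝ hx)
  have hwc : HasCompactSupport w := hcs.mono fun x hx ↦ by
    contrapose! hx
    simp [hw, Function.notMem_support.1 hx]
  have hwsub : tsupport w ⊆ tsupport ξ := closure_mono fun x hx ↦ by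
    contrapose! hx
    simp [hw, Function.notMem_support.1 hx]
  have hwC : ContDiff ℝ 1 w := contMDiff_iff_contDiff.1 <| contMDiff_of_tsupport fun x hx ↦ by
    rw [contMDiffAt_iff_contDiffAt]
    have hx0 := hne x (hwsub hx)
    exact (hξ.contDiffAt.pow 2).mul ((((contDiffAt_norm ℝ hx0).pow 2).inv
      (pow_ne_zero 2 (norm_ne_zero_iff.2 hx0))).mul (hhn x hx0).exp)
  have hw'c : Continuous (fderiv ℝ w) := hwC.continuous_fderiv one_ne_zero
  have hξ'c : Continuous (fderiv ℝ ξ) := hξ.continuous_fderiv one_ne_zero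
  have hwint : Integrable w := hwC.continuous.integrable_of_hasCompactSupport hwc
  have hdivint : Integrable fun x ↦ (k : ℝ) * w x + fderiv ℝ w x x := by
    refine (hwint.const_mul _).add (Continuous.integrable_of_hasCompactSupport (by fun_prop) ?_)
    refine (hwc.fderiv ℝ).mono fun x hx ↦ ?_
    contrapose! hx
    simp [Function.notMem_support.1 hx]
  have hJsub : Function.support (fun x ↦ ‖fderiv ℝ ξ x‖ ^ 2 * Real.exp (h ‖x‖)) ⊆
      Function.support (fderiv ℝ ξ) := fun x hx ↦ by
    contrapose! hx
    simp [Function.notMem_support.1 hx]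
  have hJint : Integrable fun x ↦ ‖fderiv ℝ ξ x‖ ^ 2 * Real.exp (h ‖x‖) := by
    refine Continuous.integrable_of_hasCompactSupport ?_ ((hcs.fderiv ℝ).mono hJsub)
    refine continuous_of_tsupport fun x hx ↦ ?_
    have hx0 := hne x (tsupport_fderiv_subset ℝ (closure_mono hJsub hx))
    exact (hξ'c.norm.pow 2).continuousAt.mul (hhn x hx0).continuousAt.rexp
  have hpt : ∀ x, a / 2 * w x - 2 / a * (‖fderiv ℝ ξ x‖ ^ 2 * Real.exp (h ‖x‖)) ≤
      (k : ℝ) * w x + fderiv ℝ w x x := by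
    intro x
    by_cases hx : x = 0
    · have hw0 : w x = 0 := by simp [hw, hx, image_eq_zero_of_notMem_tsupport h0]
      rw [hw0, hx, map_zero]
      have : 0 ≤ 2 / a * (‖fderiv ℝ ξ 0‖ ^ 2 *
        Real.exp (h ‖(0 : EuclideanSpace ℝ (Fin k))‖)) := by positivity
      linarith
    · have ht : 0 < ‖x‖ := norm_pos_iff.2 hx
      have hψ' := ((hasDerivAt_pow 2 ‖x‖).inv (pow_ne_zero 2 ht.ne')).mul
        (((hhat _ ht).differentiableAt one_ne_zero).hasDerivAt.exp)
      rw [fderiv_sq_mul_comp_norm_self (ψ := ψ) (hξ.differentiable one_ne_zero x) hx hψ']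
      have hop : |fderiv ℝ ξ x x| ≤ ‖fderiv ℝ ξ x‖ * ‖x‖ := (fderiv ℝ ξ x).le_opNorm x
      have hbt := hb' _ ht
      simp only [hw, hψ, Pi.inv_apply]
      have hd2 : fderiv ℝ ξ x x ^ 2 ≤ (‖fderiv ℝ ξ x‖ * ‖x‖) ^ 2 :=
        sq_le_sq' (abs_le.1 hop).1 (abs_le.1 hop).2
      have hrem : 0 ≤ Real.exp (h ‖x‖) / ‖x‖ ^ 2 *
          (ξ x ^ 2 * (‖x‖ * deriv h ‖x‖ - b) + (a * ξ x + 2 * fderiv ℝ ξ x x) ^ 2 / (2 * a) +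
            2 / a * ((‖fderiv ℝ ξ x‖ * ‖x‖) ^ 2 - fderiv ℝ ξ x x ^ 2)) := by
        have := sub_nonneg.2 hbt
        have := sub_nonneg.2 hd2
        positivity
      have hk' : (k : ℝ) = a + 2 - b := by rw [ha]; ring
      rw [hk', ← sub_nonneg]
      convert hrem using 1
      field_simp
      ring
  have hmono := integral_mono ((hwint.const_mul (a / 2)).sub (hJint.const_mul (2 / a))) hdivint hpt
  rw [integral_mul_add_fderiv_self_eq_zero hwC hwc] at hmono
  simp only [Pi.sub_apply] at hmono
  rw [integral_sub (hwint.const_mul _) (hJint.const_mul _), integral_const_mul,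
    integral_const_mul] at hmono
  have := mul_le_mul_of_nonneg_left hmono (half_pos ha0).le
  field_simp at this ⊢
  linarith
end

section
/- Let n ∈ ℕ, let h : ℝ → ℝ be twice continuously differentiable on (0,∞), and let ξ : ℝ → ℝ be continuously differentiable with compact support contained in (0,∞). Then ∫₀^∞ ( (d/dr)(ξ(r)·e^{h(r)/2}) )² r^{n−2} dr = ∫₀^∞ ξ'(r)² r^{n−2} e^{h(r)} dr − (1/4) ∫₀^∞ ( r·h'(r)² + 2r·h''(r) + (2n−4)·h'(r) ) ξ(r)² r^{n−3} e^{h(r)} dr. -/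
open MeasureTheory

/-- A function continuous on an open set and vanishing outside a compact subset `K` of it is
integrable there. -/
theorem ContinuousOn.integrableOn_of_forall_notMem_eq_zero {f : ℝ → ℝ} {U K : Set ℝ}
    (hU : MeasurableSet U) (hK : IsCompact K) (hKU : K ⊆ U) (hf : ContinuousOn f U)
    (hzero : ∀ x ∉ K, f x = 0) : IntegrableOn f U :=
  ((hf.mono hKU).integrableOn_compact hK).of_forall_sdiff_eq_zero hU fun x hx => hzero x hx.2

/-- The derivative of a function on `(0, ∞)` with compact support in `(0, ∞)` has zero integral. -/
theorem integral_Ioi_eq_zero_of_hasDerivAt_of_tsupport_subset {g g' : ℝ → ℝ}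
    (hderiv : ∀ x ∈ Set.Ioi (0 : ℝ), HasDerivAt g (g' x) x)
    (hint : IntegrableOn g' (Set.Ioi 0)) (hcs : HasCompactSupport g)
    (hsupp : tsupport g ⊆ Set.Ioi 0) : ∫ x in Set.Ioi (0 : ℝ), g' x = 0 := by
  have h0 : (0 : ℝ) ∉ tsupport g := fun h => lt_irrefl (0 : ℝ) (hsupp h)
  have hcont : ContinuousAt g 0 :=
    continuousAt_const.congr (notMem_tsupport_iff_eventuallyEq.mp h0).symm
  have htop : Filter.Tendsto g Filter.atTop (nhds 0) := by
    obtain ⟨b, hb⟩ := hcs.isCompact.bddAbove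
    refine tendsto_const_nhds.congr' ?_
    filter_upwards [Filter.eventually_gt_atTop b] with x hx
    exact (image_eq_zero_of_notMem_tsupport fun h => hx.not_ge (hb h)).symm
  rw [integral_Ioi_of_hasDerivAt_of_tendsto hcont.continuousWithinAt hderiv hint htop,
    image_eq_zero_of_notMem_tsupport h0, sub_zero]

/-- Integration-by-parts identity from the proof of Theorem 1.8:
`∫₀^∞ ((ξ e^{h/2})')² r^{n−2} dr
  = ∫₀^∞ (ξ')² r^{n−2} e^{h} dr − (1/4) ∫₀^∞ (r(h')² + 2r h'' + (2n−4)h') ξ² r^{n−3} e^{h} dr`. -/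
theorem weighted_integration_by_parts (n : ℕ) (h : ℝ → ℝ)
    (hh : ContDiffOn ℝ 2 h (Set.Ioi 0))
    (ξ : ℝ → ℝ) (hξ : ContDiff ℝ 1 ξ) (hcs : HasCompactSupport ξ)
    (hsupp : tsupport ξ ⊆ Set.Ioi 0) :
    ∫ r in Set.Ioi (0 : ℝ),
        (deriv (fun s => ξ s * Real.exp (h s / 2)) r) ^ 2 * r ^ ((n : ℝ) - 2) =
      (∫ r in Set.Ioi (0 : ℝ), (deriv ξ r) ^ 2 * r ^ ((n : ℝ) - 2) * Real.exp (h r)) -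
        (1 / 4) * ∫ r in Set.Ioi (0 : ℝ),
          (r * (deriv h r) ^ 2 + 2 * r * deriv (deriv h) r + (2 * (n : ℝ) - 4) * deriv h r) *
            ξ r ^ 2 * r ^ ((n : ℝ) - 3) * Real.exp (h r) := by
  have hd1 : ContDiffOn ℝ 1 (deriv h) (Set.Ioi 0) := hh.deriv_of_isOpen isOpen_Ioi (by norm_num)
  have hc0 : ContinuousOn h (Set.Ioi 0) := hh.continuousOn
  have hc1 : ContinuousOn (deriv h) (Set.Ioi 0) := hd1.continuousOn
  have hc2 : ContinuousOn (deriv (deriv h)) (Set.Ioi 0) :=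
    hd1.continuousOn_deriv_of_isOpen isOpen_Ioi le_rfl
  have hcξ : ContinuousOn ξ (Set.Ioi 0) := hξ.continuous.continuousOn
  have hcξ' : ContinuousOn (deriv ξ) (Set.Ioi 0) := (hξ.continuous_deriv le_rfl).continuousOn
  have hpow (a : ℝ) : ContinuousOn (fun r : ℝ => r ^ a) (Set.Ioi 0) :=
    continuousOn_id.rpow_const fun x hx => Or.inl (ne_of_gt hx)
  have hξd (r : ℝ) : HasDerivAt ξ (deriv ξ r) r :=
    (hξ.differentiable one_ne_zero r).hasDerivAt
  have hhd {r : ℝ} (hr : r ∈ Set.Ioi 0) : HasDerivAt h (deriv h r) r :=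
    ((hh.differentiableOn two_ne_zero).differentiableAt (isOpen_Ioi.mem_nhds hr)).hasDerivAt
  have hhd' {r : ℝ} (hr : r ∈ Set.Ioi 0) : HasDerivAt (deriv h) (deriv (deriv h) r) r :=
    ((hd1.differentiableOn one_ne_zero).differentiableAt (isOpen_Ioi.mem_nhds hr)).hasDerivAt
  have hz (x : ℝ) (hx : x ∉ tsupport ξ) : ξ x = 0 := image_eq_zero_of_notMem_tsupport hx
  have hz' (x : ℝ) (hx : x ∉ tsupport ξ) : deriv ξ x = 0 :=
    Function.notMem_support.mp fun h => hx (support_deriv_subset h)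
  let A : ℝ → ℝ := fun r => (deriv ξ r) ^ 2 * r ^ ((n : ℝ) - 2) * Real.exp (h r)
  let B : ℝ → ℝ := fun r =>
    (r * (deriv h r) ^ 2 + 2 * r * deriv (deriv h) r + (2 * (n : ℝ) - 4) * deriv h r) *
      ξ r ^ 2 * r ^ ((n : ℝ) - 3) * Real.exp (h r)
  let G : ℝ → ℝ := fun r => ξ r * (ξ r * deriv h r * r ^ ((n : ℝ) - 2) * Real.exp (h r) / 2)
  let C : ℝ → ℝ := fun r =>
    ξ r * deriv ξ r * deriv h r * r ^ ((n : ℝ) - 2) * Real.exp (h r) +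
      ξ r ^ 2 * deriv (deriv h) r * r ^ ((n : ℝ) - 2) * Real.exp (h r) / 2 +
      ξ r ^ 2 * deriv h r ^ 2 * r ^ ((n : ℝ) - 2) * Real.exp (h r) / 2 +
      ((n : ℝ) - 2) * ξ r ^ 2 * deriv h r * r ^ ((n : ℝ) - 3) * Real.exp (h r) / 2
  have integrable {f : ℝ → ℝ} (hf : ContinuousOn f (Set.Ioi 0))
      (hf0 : ∀ x ∉ tsupport ξ, f x = 0) : IntegrableOn f (Set.Ioi 0) :=
    hf.integrableOn_of_forall_notMem_eq_zero measurableSet_Ioi hcs.isCompact hsupp hf0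
  have hp2 := hpow ((n : ℝ) - 2)
  have hp3 := hpow ((n : ℝ) - 3)
  have hA : IntegrableOn A (Set.Ioi 0) :=
    integrable (by fun_prop) fun x hx => by simp [A, hz' x hx]
  have hB : IntegrableOn B (Set.Ioi 0) :=
    integrable (by fun_prop) fun x hx => by simp [B, hz x hx]
  have hC : IntegrableOn C (Set.Ioi 0) :=
    integrable (by fun_prop) fun x hx => by simp [C, hz x hx]
  have hGsupp : tsupport G ⊆ tsupport ξ := tsupport_mul_subset_left
  have hG (r : ℝ) (hr : r ∈ Set.Ioi 0) : HasDerivAt G (C r) r := by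
    have hpd := Real.hasDerivAt_rpow_const (x := r) (p := (n : ℝ) - 2) (Or.inl (ne_of_gt hr))
    rw [show (n : ℝ) - 2 - 1 = n - 3 by ring] at hpd
    have hd := ((((hξd r).mul (hhd' hr)).mul hpd).mul (hhd hr).exp).div_const 2
    refine ((hξd r).mul hd).congr_deriv ?_
    simp only [C, Pi.mul_apply]
    ring
  have hC0 : ∫ r in Set.Ioi (0 : ℝ), C r = 0 :=
    integral_Ioi_eq_zero_of_hasDerivAt_of_tsupport_subset hG hC
      (hcs.mono' (subset_closure.trans hGsupp)) (hGsupp.trans hsupp)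
  have hpt : ∀ r ∈ Set.Ioi (0 : ℝ),
      (deriv (fun s => ξ s * Real.exp (h s / 2)) r) ^ 2 * r ^ ((n : ℝ) - 2) =
        A r - 1 / 4 * B r + C r := by
    intro r hr
    have hr3 : r ^ ((n : ℝ) - 2) = r ^ ((n : ℝ) - 3) * r := by
      rw [← Real.rpow_add_one (ne_of_gt hr)]
      congr 1
      ring
    have hexp : Real.exp (h r) = Real.exp (h r / 2) ^ 2 := by
      rw [← Real.exp_nat_mul]
      congr 1
      push_cast
      ring
    rw [((hξd r).fun_mul ((hhd hr).div_const 2).exp).deriv]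
    simp only [A, B, C, hr3, hexp]
    ring
  have hAB : IntegrableOn (fun r => A r - 1 / 4 * B r) (Set.Ioi 0) := hA.sub (hB.const_mul _)
  rw [setIntegral_congr_fun measurableSet_Ioi hpt, integral_add hAB hC,
    integral_sub hA (hB.const_mul _), hC0, add_zero, integral_const_mul]
end

section
/- Let n ∈ ℕ, let λ ∈ ℝ, and let h : ℝ → ℝ be twice continuously differentiable on (0,∞) satisfying t·h'(t)² + 2t·h''(t) + 2n·h'(t) ≥ 0 for all t > 0. Suppose that for every continuously differentiable ψ : ℝ → ℝ with compact support contained in (0,∞) one has ∫₀^∞ ( r²·ψ'(r)² + λ·ψ(r)² ) r^{n−4} dr ≥ 0. Then for every continuously differentiable ψ : ℝ → ℝ with compact support contained in (0,∞), ∫₀^∞ ( r²·ψ'(r)² + λ·ψ(r)² + r·h'(r)·ψ(r)² ) r^{n−4} e^{h(r)} dr ≥ 0. -/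
open MeasureTheory

/-- A real function that is continuous on a set and vanishes outside a compact subset of it is
integrable. -/
theorem integrable_of_continuousOn_of_support_subset {f : ℝ → ℝ} {s K : Set ℝ}
    (hf : ContinuousOn f s) (hK : IsCompact K) (hKs : K ⊆ s) (hfK : Function.support f ⊆ K) :
    Integrable f :=
  (integrableOn_iff_integrable_of_support_subset hfK).1
    ((hf.mono hKs).integrableOn_compact hK)

/-- Multiplying a `C¹` function by a function that is `C¹` on an open set containing its
topological support gives a `C¹` function. -/
theorem contDiff_mul_of_tsupport_subset {f g : ℝ → ℝ} {s : Set ℝ} (hs : IsOpen s)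
    (hf : ContDiff ℝ 1 f) (hg : ContDiffOn ℝ 1 g s) (hfs : tsupport f ⊆ s) :
    ContDiff ℝ 1 (fun x => f x * g x) :=
  contMDiff_iff_contDiff.1 <| contMDiff_of_tsupport fun _ hx => contMDiffAt_iff_contDiffAt.2 <|
    hf.contDiffAt.mul (hg.contDiffAt (hs.mem_nhds (hfs (tsupport_mul_subset_left hx))))

/-- Radial analytic core of Theorem 1.8 (stability transfer): if
`t(h')² + 2t h'' + 2n h' ≥ 0` on `(0,∞)` and the unweighted radial stability inequality
`∫₀^∞ (r²(ψ')² + λψ²) r^{n−4} dr ≥ 0` holds for all test functions `ψ`, then the weighted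
stability inequality `∫₀^∞ (r²(ψ')² + λψ² + r h' ψ²) r^{n−4} e^{h} dr ≥ 0` also holds. -/
theorem stability_transfer (n : ℕ) (lam : ℝ) (h : ℝ → ℝ)
    (hh : ContDiffOn ℝ 2 h (Set.Ioi 0))
    (hA3 : ∀ t > (0 : ℝ),
      t * (deriv h t) ^ 2 + 2 * t * deriv (deriv h) t + 2 * (n : ℝ) * deriv h t ≥ 0)
    (hstab : ∀ ψ : ℝ → ℝ, ContDiff ℝ 1 ψ → HasCompactSupport ψ → tsupport ψ ⊆ Set.Ioi 0 →
      0 ≤ ∫ r in Set.Ioi (0 : ℝ),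
        (r ^ 2 * (deriv ψ r) ^ 2 + lam * ψ r ^ 2) * r ^ ((n : ℝ) - 4)) :
    ∀ ψ : ℝ → ℝ, ContDiff ℝ 1 ψ → HasCompactSupport ψ → tsupport ψ ⊆ Set.Ioi 0 →
      0 ≤ ∫ r in Set.Ioi (0 : ℝ),
        (r ^ 2 * (deriv ψ r) ^ 2 + lam * ψ r ^ 2 + r * deriv h r * ψ r ^ 2) *
          r ^ ((n : ℝ) - 4) * Real.exp (h r) := by
  intro ψ hψ hψc hψs
  have hpos : ∀ {r : ℝ}, r ∈ Set.Ioi (0 : ℝ) → Set.Ioi (0 : ℝ) ∈ nhds r :=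
    fun hr => isOpen_Ioi.mem_nhds hr
  have hd1 : ContDiffOn ℝ 1 (deriv h) (Set.Ioi 0) :=
    hh.deriv_of_isOpen isOpen_Ioi (by norm_num)
  have hh1 : ContDiffOn ℝ 1 h (Set.Ioi 0) := hh.of_le (by norm_num)
  have hrpow (p : ℝ) : ContDiffOn ℝ 1 (fun r : ℝ => r ^ p) (Set.Ioi 0) :=
    contDiffOn_id.rpow_const_of_ne fun r hr => (Set.mem_Ioi.1 hr).ne'
  have hψ0 : ψ 0 = 0 :=
    image_eq_zero_of_notMem_tsupport fun h0 => lt_irrefl _ (Set.mem_Ioi.1 (hψs h0))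
  have hψd (r : ℝ) : HasDerivAt ψ (deriv ψ r) r :=
    (hψ.differentiable one_ne_zero r).hasDerivAt
  have hhd {r : ℝ} (hr : r ∈ Set.Ioi (0 : ℝ)) : HasDerivAt h (deriv h r) r :=
    ((hh1.contDiffAt (hpos hr)).differentiableAt one_ne_zero).hasDerivAt
  have hhdd {r : ℝ} (hr : r ∈ Set.Ioi (0 : ℝ)) :
      HasDerivAt (deriv h) (deriv (deriv h) r) r :=
    ((hd1.contDiffAt (hpos hr)).differentiableAt one_ne_zero).hasDerivAt
  -- The test function `φ = ψ e^{h/2}` and the boundary term `G = (1/2) h' ψ² r^{n-2} e^h`.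
  set φ : ℝ → ℝ := fun r => ψ r * Real.exp (h r / 2) with hφdef
  set G : ℝ → ℝ :=
    fun r => ψ r * (ψ r * (deriv h r * r ^ ((n : ℝ) - 2) * Real.exp (h r) / 2)) with hGdef
  have hφ : ContDiff ℝ 1 φ :=
    contDiff_mul_of_tsupport_subset isOpen_Ioi hψ (hh1.div_const 2).exp hψs
  have hφc : HasCompactSupport φ := hψc.mul_right
  have hφs : tsupport φ ⊆ tsupport ψ := tsupport_mul_subset_left
  have hG : ContDiff ℝ 1 G :=
    contDiff_mul_of_tsupport_subset isOpen_Ioi hψ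
      (hψ.contDiffOn.mul (((hd1.mul (hrpow _)).mul hh1.exp).div_const 2)) hψs
  have hGc : HasCompactSupport G := hψc.mul_right
  have hGint : ∫ r in Set.Ioi (0 : ℝ), deriv G r = 0 := by
    rw [hGc.integral_Ioi_deriv_eq hG 0]
    simp [hGdef, hψ0]
  have hG'i : Integrable (deriv G) :=
    (hG.continuous_deriv le_rfl).integrable_of_hasCompactSupport hGc.deriv
  have hψz {r : ℝ} (hr : r ∉ tsupport ψ) : ψ r = 0 ∧ deriv ψ r = 0 :=
    ⟨image_eq_zero_of_notMem_tsupport hr,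
      Function.notMem_support.1 fun h' => hr (support_deriv_subset h')⟩
  have hφz {r : ℝ} (hr : r ∉ tsupport ψ) : φ r = 0 ∧ deriv φ r = 0 :=
    ⟨image_eq_zero_of_notMem_tsupport fun h' => hr (hφs h'),
      Function.notMem_support.1 fun h' => hr (hφs (support_deriv_subset h'))⟩
  have hφ' := (hφ.continuous_deriv le_rfl).continuousOn (s := Set.Ioi 0)
  have hψ' := (hψ.continuous_deriv le_rfl).continuousOn (s := Set.Ioi 0)
  have hφ0 := hφ.continuous.continuousOn (s := Set.Ioi 0)
  have hψ0' := hψ.continuous.continuousOn (s := Set.Ioi 0)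
  have hd0 := hd1.continuousOn
  have hr0 := (hrpow ((n : ℝ) - 4)).continuousOn
  have hh0 := hh1.continuousOn
  have hPi : Integrable fun r : ℝ =>
      (r ^ 2 * (deriv φ r) ^ 2 + lam * φ r ^ 2) * r ^ ((n : ℝ) - 4) := by
    refine integrable_of_continuousOn_of_support_subset (s := Set.Ioi 0) (by fun_prop) hψc hψs ?_
    refine Function.support_subset_iff'.2 fun r hr => ?_
    simp [hφz hr]
  have hTi : Integrable fun r : ℝ =>
      (r ^ 2 * (deriv ψ r) ^ 2 + lam * ψ r ^ 2 + r * deriv h r * ψ r ^ 2) *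
        r ^ ((n : ℝ) - 4) * Real.exp (h r) := by
    refine integrable_of_continuousOn_of_support_subset (s := Set.Ioi 0) (by fun_prop) hψc hψs ?_
    refine Function.support_subset_iff'.2 fun r hr => ?_
    simp [hψz hr]
  calc
    0 ≤ (∫ r in Set.Ioi (0 : ℝ),
          (r ^ 2 * (deriv φ r) ^ 2 + lam * φ r ^ 2) * r ^ ((n : ℝ) - 4)) -
        ∫ r in Set.Ioi (0 : ℝ), deriv G r := by
      rw [hGint, sub_zero]
      exact hstab φ hφ hφc (hφs.trans hψs)
    _ = ∫ r in Set.Ioi (0 : ℝ),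
          ((r ^ 2 * (deriv φ r) ^ 2 + lam * φ r ^ 2) * r ^ ((n : ℝ) - 4) - deriv G r) :=
      (integral_sub hPi.integrableOn hG'i.integrableOn).symm
    _ ≤ _ := by
      refine setIntegral_mono_on (hPi.sub hG'i).integrableOn hTi.integrableOn
        measurableSet_Ioi fun r hr => ?_
      have hr' : 0 < r := hr
      have hφr : deriv φ r = (deriv ψ r + deriv h r * ψ r / 2) * Real.exp (h r / 2) := by
        refine (show HasDerivAt φ _ r from (hψd r).mul ((hhd hr).div_const 2).exp).deriv.trans ?_
        ring
      have hexp : Real.exp (h r) = Real.exp (h r / 2) ^ 2 := by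
        rw [← Real.exp_nat_mul]
        congr 1
        push_cast
        ring
      have hp2 : r ^ ((n : ℝ) - 2) = r ^ ((n : ℝ) - 4) * r ^ 2 := by
        rw [← Real.rpow_add_natCast hr'.ne']
        congr 1
        push_cast
        ring
      have hp3 : r ^ ((n : ℝ) - 2 - 1) = r ^ ((n : ℝ) - 4) * r := by
        rw [← Real.rpow_add_one hr'.ne']
        congr 1
        ring
      have hGr : deriv G r =
          (deriv h r * ψ r * deriv ψ r * r ^ 2 + deriv (deriv h) r * ψ r ^ 2 * r ^ 2 / 2 +
            ((n : ℝ) - 2) / 2 * deriv h r * ψ r ^ 2 * r + deriv h r ^ 2 * ψ r ^ 2 * r ^ 2 / 2) *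
            r ^ ((n : ℝ) - 4) * Real.exp (h r) := by
        refine (show HasDerivAt G _ r from (hψd r).mul ((hψd r).mul ((((hhdd hr).mul
          (Real.hasDerivAt_rpow_const (p := (n : ℝ) - 2) (Or.inl hr'.ne'))).mul
          (hhd hr).exp).div_const 2))).deriv.trans ?_
        simp only [Pi.mul_apply]
        rw [hp3, hp2]
        ring
      have key : 0 ≤ ψ r ^ 2 * r * r ^ ((n : ℝ) - 4) * Real.exp (h r) *
          (r * deriv h r ^ 2 + 2 * r * deriv (deriv h) r + 2 * (n : ℝ) * deriv h r) :=
        mul_nonneg (by positivity) (hA3 r hr')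
      rw [hGr, hφr, hφdef]
      simp only
      rw [hexp] at key ⊢
      linarith
end

section
/- Let k ≥ 1 be a natural number, let b ∈ ℝ with b > 2 − k, and let h : ℝ → ℝ be continuously differentiable on (0,∞) with t·h'(t) ≥ b for all t > 0 and lim_{t→0⁺} e^{h(t)} t^{k} = a for some finite a ≥ 0. Then for every r > 0, ∫₀^r e^{h(t)} t^{k−1} dt < ∞. -/
open MeasureTheory

/-- If `b ≤ t h'(t)` on `(0,∞)`, then `h - b log` is nondecreasing there. -/
theorem monotoneOn_sub_mul_log_of_le_mul_deriv {h : ℝ → ℝ} {b : ℝ}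
    (hd : DifferentiableOn ℝ h (Set.Ioi 0)) (hb : ∀ t > (0 : ℝ), b ≤ t * deriv h t) :
    MonotoneOn (fun t => h t - b * Real.log t) (Set.Ioi 0) := by
  have hderiv : ∀ t ∈ Set.Ioi (0 : ℝ),
      HasDerivAt (fun t => h t - b * Real.log t) (deriv h t - b * t⁻¹) t := fun t ht =>
    ((hd t ht).differentiableAt (Ioi_mem_nhds ht)).hasDerivAt.sub
      ((Real.hasDerivAt_log (ne_of_gt ht)).const_mul b)
  refine monotoneOn_of_deriv_nonneg (convex_Ioi 0)
    (fun t ht => (hderiv t ht).continuousAt.continuousWithinAt) ?_ ?_ <;> rw [interior_Ioi]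
  · exact fun t ht => (hderiv t ht).differentiableAt.differentiableWithinAt
  · intro t ht
    rw [(hderiv t ht).deriv, sub_nonneg, ← div_eq_mul_inv, div_le_iff₀ ht, mul_comm]
    exact hb t ht

/-- If `b ≤ t h'(t)` on `(0,∞)`, then `e^h` is at most a multiple of `t^b` on `(0,r]`. -/
theorem exp_le_mul_rpow_of_le_mul_deriv {h : ℝ → ℝ} {b r t : ℝ}
    (hd : DifferentiableOn ℝ h (Set.Ioi 0)) (hb : ∀ t > (0 : ℝ), b ≤ t * deriv h t)
    (ht : 0 < t) (htr : t ≤ r) :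
    Real.exp (h t) ≤ Real.exp (h r - b * Real.log r) * t ^ b := by
  have hmono : h t - b * Real.log t ≤ h r - b * Real.log r :=
    monotoneOn_sub_mul_log_of_le_mul_deriv hd hb ht (ht.trans_le htr) htr
  rw [Real.rpow_def_of_pos ht, ← Real.exp_add, Real.exp_le_exp]
  linarith

/-- If `b ≤ t h'(t)` on `(0,∞)` and `-1 < b + s`, then `e^h t^s` is integrable on `(0,r]`. -/
theorem integrableOn_exp_mul_rpow_of_le_mul_deriv {h : ℝ → ℝ} {b s : ℝ}
    (hd : DifferentiableOn ℝ h (Set.Ioi 0)) (hb : ∀ t > (0 : ℝ), b ≤ t * deriv h t)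
    (hs : -1 < b + s) {r : ℝ} (hr : 0 ≤ r) :
    IntegrableOn (fun t => Real.exp (h t) * t ^ s) (Set.Ioc 0 r) := by
  have hint : IntegrableOn (fun t : ℝ => t ^ (b + s)) (Set.Ioc 0 r) :=
    (intervalIntegrable_iff_integrableOn_Ioc_of_le hr).1
      (intervalIntegral.intervalIntegrable_rpow' hs)
  have hcont : ContinuousOn (fun t => Real.exp (h t) * t ^ s) (Set.Ioc 0 r) :=
    (hd.continuousOn.mono fun t ht => ht.1).rexp.mul
      (continuousOn_id.rpow_const fun t ht => Or.inl ht.1.ne')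
  refine (hint.const_mul (Real.exp (h r - b * Real.log r))).mono'
    (hcont.aestronglyMeasurable measurableSet_Ioc)
    ((ae_restrict_iff' measurableSet_Ioc).2 (.of_forall fun t ht => ?_))
  have hts : 0 ≤ t ^ s := Real.rpow_nonneg ht.1.le s
  rw [Real.norm_of_nonneg (mul_nonneg (Real.exp_pos _).le hts), Real.rpow_add ht.1, ← mul_assoc]
  exact mul_le_mul_of_nonneg_right (exp_le_mul_rpow_of_le_mul_deriv hd hb ht.1 ht.2) hts

/-- Assumptions (A-1) and (A-2) imply (A-4): if `t h'(t) ≥ b > 2 − k` on `(0,∞)` and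
`e^{h(t)} t^k → a < ∞` as `t → 0⁺`, then `∫₀^r e^{h(t)} t^{k−1} dt < ∞` for every `r > 0`. -/
theorem a1_a2_implies_a4 (k : ℕ) (hk : 1 ≤ k) (b a : ℝ) (hb : b > 2 - (k : ℝ))
    (h : ℝ → ℝ) (hh : ContDiffOn ℝ 1 h (Set.Ioi 0))
    (hb' : ∀ t > (0 : ℝ), t * deriv h t ≥ b)
    (ha : 0 ≤ a)
    (hlim : Filter.Tendsto (fun t => Real.exp (h t) * t ^ (k : ℝ))
      (nhdsWithin 0 (Set.Ioi 0)) (nhds a)) :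
    ∀ r > (0 : ℝ),
      IntegrableOn (fun t => Real.exp (h t) * t ^ ((k : ℝ) - 1)) (Set.Ioc 0 r) := by
  exact fun r hr => integrableOn_exp_mul_rpow_of_le_mul_deriv
    (hh.differentiableOn one_ne_zero) hb' (by linarith) hr.le
end

section
/- Let g : ℝ → ℝ satisfy g(r) ≥ 0 for all r > 0, and suppose the function r ↦ g(r)/r is monotone nondecreasing on (0,∞). Then for all c > 0 and all t ∈ ℝ, g(√(c² + 2t²))² · (c² + t²) ≥ g(c)² · (c² + 2t²). -/
/-- The inequality behind Proposition 4.1(2) for the determinantal variety `C(2,3,1)`: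
if `g ≥ 0` on `(0,∞)` and `r ↦ g(r)/r` is nondecreasing on `(0,∞)`, then
`g(√(c²+2t²))² (c²+t²) ≥ g(c)² (c²+2t²)` for all `c > 0` and `t ∈ ℝ`. -/
theorem weighting_min_C231 (g : ℝ → ℝ) (hg : ∀ r > (0 : ℝ), 0 ≤ g r)
    (hmono : MonotoneOn (fun r => g r / r) (Set.Ioi 0)) :
    ∀ c > (0 : ℝ), ∀ t : ℝ,
      g (Real.sqrt (c ^ 2 + 2 * t ^ 2)) ^ 2 * (c ^ 2 + t ^ 2) ≥
        g c ^ 2 * (c ^ 2 + 2 * t ^ 2) := by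
  intro c hc t
  set s := √(c ^ 2 + 2 * t ^ 2)
  have hsq : s ^ 2 = c ^ 2 + 2 * t ^ 2 := Real.sq_sqrt (by positivity)
  have hs_pos : 0 < s := Real.sqrt_pos.2 (by positivity)
  have hcs : c ≤ s := Real.le_sqrt_of_sq_le (by nlinarith [sq_nonneg t])
  have hcross : g c * s ≤ g s * c :=
    (div_le_div_iff₀ hc hs_pos).1 (hmono hc hs_pos hcs)
  have hcross_sq : (g c * s) ^ 2 ≤ (g s * c) ^ 2 :=
    pow_le_pow_left₀ (mul_nonneg (hg c hc) hs_pos.le) hcross 2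
  rw [ge_iff_le, ← hsq]
  nlinarith [mul_nonneg (sq_nonneg (g s)) (sq_nonneg t)]
end

section
/- Let m ≥ 2 and let g : ℝ → ℝ be continuously differentiable on (0,∞) with g(r) ≥ 0 for all r > 0. Suppose that for every strictly decreasing tuple of positive reals c_0 > c_1 > … > c_{m−1} > 0 and every t ∈ ℝ one has g(√(Σ_i c_i² + (m+1)t²))² ≥ g(√(Σ_i c_i²))² · (1 + t²·Σ_i 1/(c_i² + t²)). Then g(r) = 0 for all r > 0. -/
open Finset

/-- A positive number `s` splits as a sum of `m ≥ 2` strictly decreasing positive terms, one of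
which is as small as desired. -/
lemma exists_strictAnti_sum_eq {m : ℕ} (hm : 2 ≤ m) {s ε : ℝ} (hs : 0 < s) (hε : 0 < ε) :
    ∃ v : Fin m → ℝ, StrictAnti v ∧ (∀ i, 0 < v i) ∧ ∑ i, v i = s ∧ ∃ k, v k ≤ ε := by
  have hm0 : (0 : ℝ) < m := by exact_mod_cast (by omega : 0 < m)
  set δ : ℝ := min ε (s / (m : ℝ) ^ 2)
  have hδ : 0 < δ := lt_min hε (by positivity)
  have hδs : δ * (m : ℝ) ^ 2 ≤ s := by
    rw [← le_div_iff₀ (by positivity)]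
    exact min_le_right _ _
  set S : ℝ := ∑ i : Fin m, δ * ((m : ℝ) - (i : ℕ))
  have hS : S ≤ s := by
    calc S ≤ ∑ _i : Fin m, δ * (m : ℝ) := by
          refine Finset.sum_le_sum fun i _ => mul_le_mul_of_nonneg_left ?_ hδ.le
          simp
      _ = δ * (m : ℝ) ^ 2 := by simp; ring
      _ ≤ s := hδs
  let z : Fin m := ⟨0, by omega⟩
  refine ⟨fun i => δ * ((m : ℝ) - (i : ℕ)) + if i = z then s - S else 0, ?_, ?_, ?_,
    ⟨m - 1, by omega⟩, ?_⟩
  · intro i j hij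
    have hj : j ≠ z := by
      rintro rfl
      exact Nat.not_lt_zero _ hij
    have hlt : δ * ((m : ℝ) - (j : ℕ)) < δ * ((m : ℝ) - (i : ℕ)) := by
      have : ((i : ℕ) : ℝ) < (j : ℕ) := by exact_mod_cast hij
      gcongr
    simp only [hj, if_false, add_zero]
    split_ifs <;> linarith
  · intro i
    have : 0 < δ * ((m : ℝ) - (i : ℕ)) :=
      mul_pos hδ (sub_pos.2 (by exact_mod_cast i.isLt))
    dsimp only
    split_ifs <;> linarith
  · rw [Finset.sum_add_distrib, Finset.sum_ite_eq' univ z]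
    simp [S]
  · have hk : (⟨m - 1, by omega⟩ : Fin m) ≠ z := by
      simp only [z, ne_eq, Fin.mk.injEq]
      omega
    simp only [hk, if_false, add_zero, Nat.cast_sub (by omega : 1 ≤ m)]
    calc _ = δ := by push_cast; ring
      _ ≤ ε := min_le_left _ _

/-- Proposition 4.1(3), form relevant to `C(n,n+1,n−1)`, `n = m+1 ≥ 3`: no nonzero
nonnegative `C¹` radial density `g` can satisfy
`g(√(Σcᵢ² + (m+1)t²))² ≥ g(√(Σcᵢ²))² (1 + t² Σᵢ 1/(cᵢ²+t²))`
for all strictly decreasing positive tuples `c` and all `t`. -/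
theorem no_density_C_n_np1 (m : ℕ) (hm : 2 ≤ m) (g : ℝ → ℝ)
    (hg : ContDiffOn ℝ 1 g (Set.Ioi 0)) (hg0 : ∀ r > (0 : ℝ), 0 ≤ g r)
    (H : ∀ c : Fin m → ℝ, StrictAnti c → (∀ i, 0 < c i) → ∀ t : ℝ,
      g (Real.sqrt (∑ i, c i ^ 2 + ((m : ℝ) + 1) * t ^ 2)) ^ 2 ≥
        g (Real.sqrt (∑ i, c i ^ 2)) ^ 2 *
          (1 + t ^ 2 * ∑ i, 1 / (c i ^ 2 + t ^ 2))) :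
    ∀ r > (0 : ℝ), g r = 0 := by
  intro r hr
  have key : ∀ t : ℝ, t ≠ 0 →
      g r ^ 2 * (3 / 2) ≤ g (Real.sqrt (r ^ 2 + ((m : ℝ) + 1) * t ^ 2)) ^ 2 := by
    intro t ht
    have ht2 : 0 < t ^ 2 := by positivity
    obtain ⟨v, hv, hpos, hsum, k, hk⟩ :=
      exists_strictAnti_sum_eq hm (by positivity : 0 < r ^ 2) ht2
    have hsq : ∀ i, Real.sqrt (v i) ^ 2 = v i := fun i => Real.sq_sqrt (hpos i).le
    have h := H (fun i => Real.sqrt (v i))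
      (fun i j hij => Real.sqrt_lt_sqrt (hpos j).le (hv hij))
      (fun i => Real.sqrt_pos.2 (hpos i)) t
    simp only [hsq, hsum, Real.sqrt_sq hr.le] at h
    refine le_trans (mul_le_mul_of_nonneg_left ?_ (sq_nonneg _)) h
    have hle : 1 / (v k + t ^ 2) ≤ ∑ i, 1 / (v i + t ^ 2) :=
      Finset.single_le_sum (f := fun i => 1 / (v i + t ^ 2))
        (fun i _ => by have := hpos i; positivity) (mem_univ k)
    have hhalf : 1 / 2 ≤ t ^ 2 * (1 / (v k + t ^ 2)) := by
      have := hpos k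
      rw [mul_one_div, div_le_div_iff₀ (by norm_num) (by positivity)]
      linarith
    linarith [mul_le_mul_of_nonneg_left hle ht2.le]
  have hgr : ContinuousAt g r := hg.continuousOn.continuousAt (Ioi_mem_nhds hr)
  have hcont : ContinuousAt
      (fun t : ℝ => g (Real.sqrt (r ^ 2 + ((m : ℝ) + 1) * t ^ 2)) ^ 2) 0 := by
    refine ContinuousAt.pow (ContinuousAt.comp ?_ (by fun_prop)) 2
    simpa [Real.sqrt_sq hr.le] using hgr
  have hlim := ge_of_tendsto (hcont.tendsto.mono_left (nhdsWithin_le_nhds (s := {0}ᶜ)))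
    (eventually_nhdsWithin_of_forall key)
  simp only [ne_eq, OfNat.ofNat_ne_zero, not_false_eq_true, zero_pow, mul_zero, add_zero,
    Real.sqrt_sq hr.le] at hlim
  exact pow_eq_zero_iff two_ne_zero |>.1 (le_antisymm (by linarith) (sq_nonneg _))
end

section
/- Let m ≥ 2 and let g : ℝ → ℝ be continuously differentiable on (0,∞) with g(r) ≥ 0 for all r > 0. Suppose that for every strictly decreasing tuple of positive reals c_0 > c_1 > … > c_{m−1} > 0 and every t ∈ ℝ one has g(√(Σ_i c_i² + (m+1)t²))² · ∏_i c_i² ≥ g(√(Σ_i c_i²))² · ∏_i (c_i² + t²) · (1 + t²·Σ_i 1/(c_i² + t²)). Then g(r) = 0 for all r > 0. -/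
open Finset

open Filter Topology in
/-- For `m ≥ 2`, strictly decreasing positive tuples with a prescribed sum of squares can have
arbitrarily small product of squares. -/
theorem exists_strictAnti_sum_sq_eq_prod_sq_lt {m : ℕ} (hm : 2 ≤ m) {r ε : ℝ} (hr : 0 < r)
    (hε : 0 < ε) :
    ∃ c : Fin m → ℝ, StrictAnti c ∧ (∀ i, 0 < c i) ∧ ∑ i, c i ^ 2 = r ^ 2 ∧
      ∏ i, c i ^ 2 < ε := by
  let S : ℝ → ℝ := fun d => ∑ i : Fin m, (d ^ (i : ℕ)) ^ 2
  have hS : ∀ d, 0 < S d := fun d =>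
    Finset.sum_pos' (fun _ _ => sq_nonneg _) ⟨⟨0, by omega⟩, mem_univ _, by simp⟩
  let c : ℝ → Fin m → ℝ := fun d i => r / √(S d) * d ^ (i : ℕ)
  have hsqrt : ∀ d, 0 < √(S d) := fun d => Real.sqrt_pos.2 (hS d)
  have hcont : Continuous fun d => ∏ i, c d i ^ 2 := by
    have hSc : Continuous fun d => √(S d) := by fun_prop
    have hq : Continuous fun d => r / √(S d) := continuous_const.div hSc fun d => (hsqrt d).ne'
    fun_prop
  have hzero : ∏ i, c 0 i ^ 2 = 0 :=
    Finset.prod_eq_zero (mem_univ (⟨1, by omega⟩ : Fin m)) (by simp [c])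
  have hsmall : ∀ᶠ d in 𝓝[>] (0 : ℝ), ∏ i, c d i ^ 2 < ε :=
    (hcont.tendsto 0).mono_left nhdsWithin_le_nhds |>.eventually_lt_const (by rwa [hzero])
  obtain ⟨d, hd, hd0, hd1⟩ :=
    (hsmall.and (Ioo_mem_nhdsGT (zero_lt_one (α := ℝ)))).exists
  have hl : 0 < r / √(S d) := div_pos hr (hsqrt d)
  refine ⟨c d, fun i j hij => ?_, fun i => mul_pos hl (pow_pos hd0 _), ?_, hd⟩
  · exact mul_lt_mul_of_pos_left (pow_lt_pow_right_of_lt_one₀ hd0 hd1 hij) hl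
  · have : ∑ i, c d i ^ 2 = (r / √(S d)) ^ 2 * S d := by
      simp only [c, S, mul_pow, Finset.mul_sum]
    rw [this, div_pow, Real.sq_sqrt (hS d).le, div_mul_cancel₀ _ (hS d).ne']

/-- Proposition 4.1(3), form relevant to `C(n,n,n−1)` and `C(2n,2n−2)`, `n = m+1 ≥ 3`: no
nonzero nonnegative `C¹` radial density `g` can satisfy
`g(√(Σcᵢ² + (m+1)t²))² ∏cᵢ² ≥ g(√(Σcᵢ²))² ∏(cᵢ²+t²) (1 + t² Σᵢ 1/(cᵢ²+t²))`
for all strictly decreasing positive tuples `c` and all `t`. -/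
theorem no_density_hypersurfaces (m : ℕ) (hm : 2 ≤ m) (g : ℝ → ℝ)
    (hg : ContDiffOn ℝ 1 g (Set.Ioi 0)) (hg0 : ∀ r > (0 : ℝ), 0 ≤ g r)
    (H : ∀ c : Fin m → ℝ, StrictAnti c → (∀ i, 0 < c i) → ∀ t : ℝ,
      g (Real.sqrt (∑ i, c i ^ 2 + ((m : ℝ) + 1) * t ^ 2)) ^ 2 * ∏ i, c i ^ 2 ≥
        g (Real.sqrt (∑ i, c i ^ 2)) ^ 2 * (∏ i, (c i ^ 2 + t ^ 2)) *
          (1 + t ^ 2 * ∑ i, 1 / (c i ^ 2 + t ^ 2))) :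
    ∀ r > (0 : ℝ), g r = 0 := by
  intro r hr
  set M := g √(r ^ 2 + ((m : ℝ) + 1) * 1 ^ 2) ^ 2 with hM
  have hM0 : 0 ≤ M := sq_nonneg _
  have key : g r ^ 2 ≤ 0 := by
    refine le_of_forall_pos_le_add fun ε hε => ?_
    obtain ⟨c, hanti, hpos, hsum, hprod⟩ :=
      exists_strictAnti_sum_sq_eq_prod_sq_lt hm hr (div_pos hε (by positivity : 0 < M + 1))
    have h := H c hanti hpos 1
    rw [hsum, Real.sqrt_sq hr.le, ← hM] at h
    have h1 : 1 ≤ ∏ i, (c i ^ 2 + 1 ^ 2) :=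
      Finset.one_le_prod fun i _ => by nlinarith [sq_nonneg (c i)]
    have h2 : 1 ≤ 1 + (1 : ℝ) ^ 2 * ∑ i, 1 / (c i ^ 2 + 1 ^ 2) :=
      le_add_of_nonneg_right (by positivity)
    calc g r ^ 2 ≤ g r ^ 2 * (∏ i, (c i ^ 2 + 1 ^ 2)) := le_mul_of_one_le_right (sq_nonneg _) h1
      _ ≤ _ := le_mul_of_one_le_right (by positivity) h2
      _ ≤ M * ∏ i, c i ^ 2 := h
      _ ≤ M * (ε / (M + 1)) := by gcongr
      _ ≤ 0 + ε := by
        rw [zero_add, mul_div_assoc', div_le_iff₀ (by positivity)]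
        nlinarith
  exact pow_eq_zero_iff two_ne_zero |>.1 (le_antisymm key (sq_nonneg _))
end
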